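/- arXiv:2411.17166 — 3 statements merged into one kernel-verified Lean document; each statement's English description precedes it below -/
import Mathlib

section
/- Define β_p(g) = (α+α')/2 + (1/2)·Im(√(D_p(g)))/Im(g) for g ∈ ℂ ∖ (I_p ∪ ℝ); this equals (α+α')/2 + (1/2)·(√(D_p(g)) − √(D_p(conj(g))))/(g − conj(g)). Then β_p is real-valued and continuous on ℂ ∖ (I_p ∪ ℝ), and the function obtained by additionally setting β_p(t) = (α+α')/2 + (1/2)·𝒜(𝒜t + (1−2a))/√(D_p(t)) for t ∈ ℝ is continuous on ℂ ∖ I_p. For g₀ ∈ I_p, the limit of β_p(g) as g → g₀ from the right equals (α+α')/2 + √(−D_p(g₀))/(2|Im(g₀)|), and the limit from the left equals (α+α')/2 − √(−D_p(g₀))/(2|Im(g₀)|). -/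
open Set Filter

namespace Complex

lemma cpow_half_sq (z : ℂ) : (z ^ ((1 : ℂ) / 2)) ^ 2 = z := by
  rw [one_div, cpow_ofNat_inv_pow]

lemma cpow_half_re (z : ℂ) :
    (z ^ ((1 : ℂ) / 2)).re = √‖z‖ * Real.cos (z.arg * (1 / 2)) := by
  have h := cpow_ofReal_re z (1 / 2)
  rw [← Real.sqrt_eq_rpow] at h
  simpa using h

lemma cpow_half_im (z : ℂ) :
    (z ^ ((1 : ℂ) / 2)).im = √‖z‖ * Real.sin (z.arg * (1 / 2)) := by
  have h := cpow_ofReal_im z (1 / 2)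
  rw [← Real.sqrt_eq_rpow] at h
  simpa using h

lemma cpow_half_re_pos {z : ℂ} (hz : z ∈ slitPlane) : 0 < (z ^ ((1 : ℂ) / 2)).re := by
  rw [cpow_half_re]
  have hlt := (arg_le_pi z).lt_of_ne (slitPlane_arg_ne_pi hz)
  have hgt := neg_pi_lt_arg z
  exact mul_pos (Real.sqrt_pos.2 (norm_pos_iff.2 (slitPlane_ne_zero hz)))
    (Real.cos_pos_of_mem_Ioo ⟨by linarith, by linarith⟩)

lemma two_mul_cpow_half_re_mul_im (z : ℂ) :
    2 * (z ^ ((1 : ℂ) / 2)).re * (z ^ ((1 : ℂ) / 2)).im = z.im := by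
  have h := congrArg im (cpow_half_sq z)
  rw [sq, mul_im] at h
  linarith

lemma ofReal_cpow_half_re {x : ℝ} (hx : 0 ≤ x) : ((x : ℂ) ^ ((1 : ℂ) / 2)).re = √x := by
  rw [cpow_half_re, arg_ofReal_of_nonneg hx, norm_real, Real.norm_of_nonneg hx]
  simp

lemma tendsto_cpow_half_im_of_tendsto_arg {z : ℂ} {l : Filter ℂ} {θ : ℝ}
    (hl : l ≤ nhds z) (hre : z.re < 0) (him : z.im = 0) (h : Tendsto arg l (nhds θ)) :
    Tendsto (fun w : ℂ => (w ^ ((1 : ℂ) / 2)).im) l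
      (nhds (√(-z.re) * Real.sin (θ * (1 / 2)))) := by
  simp only [cpow_half_im]
  have hz : ‖z‖ = -z.re := by
    rw [show z = (z.re : ℂ) from ext rfl (by simpa using him), norm_real, Real.norm_of_nonpos hre.le,
      ofReal_re]
  rw [← hz]
  exact (((Real.continuous_sqrt.comp continuous_norm).tendsto z).mono_left hl).mul
    ((Real.continuous_sin.tendsto _).comp (h.mul_const _))

lemma tendsto_cpow_half_im_of_im_pos {z : ℂ} (hre : z.re < 0) (him : z.im = 0) :
    Tendsto (fun w : ℂ => (w ^ ((1 : ℂ) / 2)).im) (nhdsWithin z {w | 0 < w.im})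
      (nhds (√(-z.re))) := by
  have h := tendsto_cpow_half_im_of_tendsto_arg nhdsWithin_le_nhds hre him
    (tendsto_arg_nhdsWithin_im_nonneg_of_re_neg_of_im_zero hre him)
  rw [mul_one_div, Real.sin_pi_div_two, mul_one] at h
  exact h.mono_left (nhdsWithin_mono z fun w (hw : 0 < w.im) => hw.le)

lemma tendsto_cpow_half_im_of_im_neg {z : ℂ} (hre : z.re < 0) (him : z.im = 0) :
    Tendsto (fun w : ℂ => (w ^ ((1 : ℂ) / 2)).im) (nhdsWithin z {w | w.im < 0})
      (nhds (-√(-z.re))) := by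
  have h := tendsto_cpow_half_im_of_tendsto_arg nhdsWithin_le_nhds hre him
    (tendsto_arg_nhdsWithin_im_neg_of_re_neg_of_im_zero hre him)
  rwa [mul_one_div, neg_div, Real.sin_neg, Real.sin_pi_div_two, mul_neg_one] at h

end Complex

theorem stmt6 (a α α' : ℝ) (ha : a ∈ Ioo (0 : ℝ) 1) (hαα : α ≠ α')
    (𝒜 : ℝ) (h𝒜 : 𝒜 = α' - α)
    (Dp : ℂ → ℂ)
    (hDp : ∀ w : ℂ, Dp w = ((𝒜 : ℂ) * w + ((1 - 2 * a : ℝ) : ℂ)) ^ 2 + ((4 * a * (1 - a : ℝ)) : ℂ))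
    (Ip : Set ℂ)
    (hIp : Ip = {w : ℂ | w.re = -(1 - 2 * a) / 𝒜 ∧ 2 * Real.sqrt (a * (1 - a)) / |𝒜| < |w.im|})
    (βp : ℂ → ℝ)
    -- β_p(g) = (α+α')/2 + (1/2)·Im(√(D_p(g)))/Im(g) off the real axis
    (hβp : ∀ g : ℂ, g.im ≠ 0 →
      βp g = (α + α') / 2 + (1 / 2) * ((Dp g) ^ ((1 : ℂ) / 2)).im / g.im)
    -- the continuous extension to ℝ
    (hβpR : ∀ t : ℝ, βp (t : ℂ) = (α + α') / 2 +
      (1 / 2) * (𝒜 * (𝒜 * t + (1 - 2 * a)) / Real.sqrt ((𝒜 * t + (1 - 2 * a)) ^ 2 + 4 * a * (1 - a)))) :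
    -- β_p is real-valued: the quotient identity
    (∀ g : ℂ, g.im ≠ 0 → g ∉ Ip →
      ((βp g : ℝ) : ℂ) = (((α + α') / 2 : ℝ) : ℂ) +
        (1 / 2) * (((Dp g) ^ ((1 : ℂ) / 2) - (Dp ((starRingEnd ℂ) g)) ^ ((1 : ℂ) / 2)) /
          (g - (starRingEnd ℂ) g)))
    -- continuity off I_p ∪ ℝ
    ∧ ContinuousOn βp (Ip ∪ {w : ℂ | w.im = 0})ᶜ
    -- the extension is continuous off I_p
    ∧ ContinuousOn βp Ipᶜ
    -- one-sided limits at I_p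
    ∧ (∀ g₀ ∈ Ip,
        Tendsto βp (nhdsWithin g₀ ({w : ℂ | g₀.re < w.re} ∩ (Ip ∪ {w : ℂ | w.im = 0})ᶜ))
          (nhds ((α + α') / 2 + Real.sqrt (-(Dp g₀).re) / (2 * |g₀.im|)))
        ∧ Tendsto βp (nhdsWithin g₀ ({w : ℂ | w.re < g₀.re} ∩ (Ip ∪ {w : ℂ | w.im = 0})ᶜ))
          (nhds ((α + α') / 2 - Real.sqrt (-(Dp g₀).re) / (2 * |g₀.im|)))) := by
  obtain ⟨ha0, ha1⟩ := ha
  have hA : 𝒜 ≠ 0 := by rw [h𝒜]; exact sub_ne_zero.2 hαα.symm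
  have hc : 0 < a * (1 - a) := mul_pos ha0 (by linarith)
  have hDre (w : ℂ) : (Dp w).re =
      (𝒜 * w.re + (1 - 2 * a)) ^ 2 - 𝒜 ^ 2 * w.im ^ 2 + 4 * a * (1 - a) := by
    rw [hDp]
    simp [sq]
    ring
  have hDim (w : ℂ) : (Dp w).im = 2 * ((𝒜 * w.re + (1 - 2 * a)) * 𝒜) * w.im := by
    rw [hDp]
    simp [sq]
    ring
  have hDcont : Continuous Dp := by
    rw [funext hDp]
    fun_prop
  have hmem (w : ℂ) : w ∈ Ip ↔ (Dp w).re < 0 ∧ (Dp w).im = 0 := by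
    have h1 : w.re = -(1 - 2 * a) / 𝒜 ↔ 𝒜 * w.re + (1 - 2 * a) = 0 := by
      rw [eq_div_iff hA]
      constructor <;> intro h <;> linarith
    have h2 : 2 * √(a * (1 - a)) / |𝒜| < |w.im| ↔ 4 * (a * (1 - a)) < 𝒜 ^ 2 * w.im ^ 2 := by
      rw [div_lt_iff₀ (abs_pos.2 hA), ← abs_mul, ← abs_of_nonneg (by positivity :
        0 ≤ 2 * √(a * (1 - a))), ← sq_lt_sq, mul_pow, Real.sq_sqrt hc.le, mul_pow]
      constructor <;> intro h <;> linarith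
    rw [hIp, mem_ofPred, h1, h2, hDre, hDim]
    constructor
    · rintro ⟨h, h'⟩
      rw [h]
      exact ⟨by linarith, by ring⟩
    · rintro ⟨h, h'⟩
      have hy : w.im ≠ 0 := by
        intro hy
        rw [hy] at h
        nlinarith [sq_nonneg (𝒜 * w.re + (1 - 2 * a))]
      have h0 : 𝒜 * w.re + (1 - 2 * a) = 0 := by simpa [hA, hy] using h'
      rw [h0] at h
      exact ⟨h0, by linarith⟩
  have hnotMem {w : ℂ} (hw : w ∉ Ip) : 0 ≤ (Dp w).re ∨ (Dp w).im ≠ 0 := by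
    by_contra! h
    exact hw ((hmem w).2 h)
  have hslit (w : ℂ) (hw : Dp w ∈ Complex.slitPlane) : βp w = (α + α') / 2 +
      (1 / 2) * (𝒜 * (𝒜 * w.re + (1 - 2 * a)) / ((Dp w) ^ ((1 : ℂ) / 2)).re) := by
    have hs := Complex.cpow_half_re_pos hw
    by_cases hy : w.im = 0
    · have hwr : w = (w.re : ℂ) := Complex.ext rfl (by simpa using hy)
      have hDr : Dp w = (((𝒜 * w.re + (1 - 2 * a)) ^ 2 + 4 * a * (1 - a) : ℝ) : ℂ) :=
        Complex.ext (by rw [hDre, hy, Complex.ofReal_re]; ring)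
          (by rw [hDim, hy, Complex.ofReal_im, mul_zero])
      have hnonneg : 0 ≤ (𝒜 * w.re + (1 - 2 * a)) ^ 2 + 4 * a * (1 - a) := by
        nlinarith [sq_nonneg (𝒜 * w.re + (1 - 2 * a))]
      rw [hDr, Complex.ofReal_cpow_half_re hnonneg, ← hβpR, ← hwr]
    · have h := Complex.two_mul_cpow_half_re_mul_im (Dp w)
      rw [hDim] at h
      rw [hβp w hy, mul_div_assoc]
      congr 2
      rw [div_eq_div_iff hy hs.ne']
      linarith
  have hcont (w : ℂ) (hw : w ∉ Ip) : ContinuousAt βp w := by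
    have hpow : ContinuousAt (fun w => (Dp w) ^ ((1 : ℂ) / 2)) w :=
      ContinuousAt.comp (g := fun z : ℂ => z ^ ((1 : ℂ) / 2))
        (Complex.continuousAt_cpow_const_of_re_pos (hnotMem hw) (by norm_num)) hDcont.continuousAt
    by_cases hy : w.im = 0
    · have hDw : Dp w ∈ Complex.slitPlane := by
        refine Or.inl ?_
        rw [hDre, hy]
        nlinarith [sq_nonneg (𝒜 * w.re + (1 - 2 * a))]
      have hev : ∀ᶠ v in nhds w, Dp v ∈ Complex.slitPlane :=
        hDcont.continuousAt.eventually_mem (Complex.isOpen_slitPlane.mem_nhds hDw)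
      refine ContinuousAt.congr ?_ (hev.mono fun v hv => (hslit v hv).symm)
      have hre := Complex.continuous_re.continuousAt.comp hpow
      refine continuousAt_const.add (continuousAt_const.mul (ContinuousAt.div ?_ hre
        (Complex.cpow_half_re_pos hDw).ne'))
      exact Continuous.continuousAt (by fun_prop)
    · have hev : ∀ᶠ v in nhds w, v.im ≠ 0 :=
        Complex.continuous_im.continuousAt.eventually_ne hy
      refine ContinuousAt.congr ?_ (hev.mono fun v hv => (hβp v hv).symm)
      exact continuousAt_const.add ((continuousAt_const.mul
        (Complex.continuous_im.continuousAt.comp hpow)).div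
        Complex.continuous_im.continuousAt hy)
  refine ⟨fun g hg hgI => ?_, fun w hw => (hcont w fun h => hw (Or.inl h)).continuousWithinAt,
    fun w hw => (hcont w hw).continuousWithinAt, fun g₀ hg₀ => ?_⟩
  · have hconj : Dp ((starRingEnd ℂ) g) = (starRingEnd ℂ) (Dp g) := by simp [hDp, map_ofNat]
    have harg : (Dp g).arg ≠ Real.pi := (Complex.arg_lt_pi_iff.2 (hnotMem hgI)).ne
    have hhalf : (starRingEnd ℂ) ((1 : ℂ) / 2) = 1 / 2 := by simp [map_ofNat]
    have hg' : (g.im : ℂ) ≠ 0 := Complex.ofReal_ne_zero.2 hg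
    rw [hconj, Complex.conj_cpow _ _ harg, hhalf, Complex.sub_conj, Complex.sub_conj, hβp g hg]
    push_cast
    field_simp
  · obtain ⟨hre, him⟩ := (hmem g₀).1 hg₀
    have hy : g₀.im ≠ 0 := by
      intro hy
      rw [hDre, hy] at hre
      nlinarith [sq_nonneg (𝒜 * g₀.re + (1 - 2 * a))]
    have hx : 𝒜 * g₀.re + (1 - 2 * a) = 0 := by
      rw [hDim] at him
      simpa [hA, hy] using him
    have hDim' (w : ℂ) : (Dp w).im = 2 * 𝒜 ^ 2 * ((w.re - g₀.re) * w.im) := by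
      rw [hDim]
      linear_combination (2 * 𝒜 * w.im) * hx
    have hne {s : Set ℂ} : ∀ᶠ w in nhdsWithin g₀ s, w.im ≠ 0 :=
      nhdsWithin_le_nhds (Complex.continuous_im.continuousAt.eventually_ne hy)
    have hlim {s : Set ℂ} {r : ℝ}
        (h : Tendsto (fun w => ((Dp w) ^ ((1 : ℂ) / 2)).im) (nhdsWithin g₀ s) (nhds r)) :
        Tendsto βp (nhdsWithin g₀ s) (nhds ((α + α') / 2 + (1 / 2) * r / g₀.im)) :=
      (tendsto_const_nhds.add ((tendsto_const_nhds.mul h).div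
        (Complex.continuous_im.continuousAt.mono_left nhdsWithin_le_nhds) hy)).congr'
        (hne.mono fun w hw => (hβp w hw).symm)
    have hpos {s : Set ℂ} (h : ∀ᶠ w in nhdsWithin g₀ s, 0 < (w.re - g₀.re) * w.im) :
        Tendsto βp (nhdsWithin g₀ s)
          (nhds ((α + α') / 2 + (1 / 2) * √(-(Dp g₀).re) / g₀.im)) := by
      refine hlim ((Complex.tendsto_cpow_half_im_of_im_pos hre him).comp
        (tendsto_nhdsWithin_iff.2 ⟨hDcont.continuousAt.mono_left nhdsWithin_le_nhds,
          h.mono fun w hw => ?_⟩))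
      rw [mem_ofPred, hDim']
      positivity
    have hneg {s : Set ℂ} (h : ∀ᶠ w in nhdsWithin g₀ s, (w.re - g₀.re) * w.im < 0) :
        Tendsto βp (nhdsWithin g₀ s)
          (nhds ((α + α') / 2 + (1 / 2) * -√(-(Dp g₀).re) / g₀.im)) := by
      refine hlim ((Complex.tendsto_cpow_half_im_of_im_neg hre him).comp
        (tendsto_nhdsWithin_iff.2 ⟨hDcont.continuousAt.mono_left nhdsWithin_le_nhds,
          h.mono fun w hw => ?_⟩))
      rw [mem_ofPred, hDim']
      exact mul_neg_of_pos_of_neg (by positivity) hw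
    rcases lt_or_gt_of_ne hy with hy' | hy'
    · have hev {s : Set ℂ} : ∀ᶠ w in nhdsWithin g₀ s, w.im < 0 :=
        nhdsWithin_le_nhds (Complex.continuous_im.continuousAt.eventually_lt_const hy')
      rw [abs_of_neg hy']
      constructor
      · convert hneg _ using 2
        · field_simp
        · filter_upwards [hev, self_mem_nhdsWithin] with w hw hw'
          exact mul_neg_of_pos_of_neg (sub_pos.2 hw'.1) hw
      · convert hpos _ using 2
        · field_simp
          ring
        · filter_upwards [hev, self_mem_nhdsWithin] with w hw hw'
          exact mul_pos_of_neg_of_neg (sub_neg.2 hw'.1) hw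
    · have hev {s : Set ℂ} : ∀ᶠ w in nhdsWithin g₀ s, 0 < w.im :=
        nhdsWithin_le_nhds (Complex.continuous_im.continuousAt.eventually_const_lt hy')
      rw [abs_of_pos hy']
      constructor
      · convert hpos _ using 2
        · field_simp
        · filter_upwards [hev, self_mem_nhdsWithin] with w hw hw'
          exact mul_pos (sub_pos.2 hw'.1) hw
      · convert hneg _ using 2
        · field_simp
          ring
        · filter_upwards [hev, self_mem_nhdsWithin] with w hw hw'
          exact mul_neg_of_neg_of_pos (sub_neg.2 hw'.1) hw
end

section
/- Let n, k ≥ 1. In the ring ℂ[m, x, y][g], the resultant with respect to g, computed with respect to the formal degrees n and k, of the polynomials (xg + m)^{n−1}·(xg + m − 1) and (iyg + 1 − m)^{k−1}·(iyg − m) equals (−1)^{nk}·m^{n−1}(m−1)^{k−1}·(x + iy)^{n+k−2}·((m−1)x + imy)^{(n−1)(k−1)}·(mx + i(m−1)y), where i is the imaginary unit. -/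
/-- The Sylvester matrix of two coefficient sequences `a` (of formal degree `n`)
and `b` (of formal degree `k`); its determinant is the resultant with respect to
the formal degrees `n` and `k`. -/
def sylvester {R : Type*} [CommRing R] (n k : ℕ) (a b : ℕ → R) :
    Matrix (Fin (n + k)) (Fin (n + k)) R :=
  Matrix.of fun i j =>
    if (j : ℕ) < k then
      (if (j : ℕ) ≤ (i : ℕ) ∧ (i : ℕ) ≤ (j : ℕ) + n then a (n + (j : ℕ) - (i : ℕ)) else 0)
    else
      (if (j : ℕ) - k ≤ (i : ℕ) ∧ (i : ℕ) ≤ ((j : ℕ) - k) + k then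
        b (k + ((j : ℕ) - k) - (i : ℕ)) else 0)

/-- The determinant of `sylvester` is Mathlib's resultant: the two Sylvester matrices differ by
reversing the order of both the rows and the columns. -/
theorem det_sylvester_coeff {R : Type*} [CommRing R] (n k : ℕ) (f g : Polynomial R) :
    (sylvester n k f.coeff g.coeff).det = f.resultant g n k := by
  rw [Polynomial.resultant, ← Matrix.det_submatrix_equiv_self Fin.revPerm (sylvester n k f.coeff g.coeff)]
  congr 1
  ext i j
  have hi := i.isLt
  induction j using Fin.addCases with
  | left j =>
    have hj := j.isLt
    simp only [sylvester, Polynomial.sylvester, Matrix.submatrix_apply, Matrix.of_apply,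
      Fin.revPerm_apply, Fin.val_rev, Fin.addCases_left, Fin.val_castAdd, Set.mem_Icc]
    rw [if_neg (by lia)]
    refine ite_congr (propext (by lia)) (fun _ => congrArg g.coeff (by lia)) fun _ => rfl
  | right j =>
    have hj := j.isLt
    simp only [sylvester, Polynomial.sylvester, Matrix.submatrix_apply, Matrix.of_apply,
      Fin.revPerm_apply, Fin.val_rev, Fin.addCases_right, Fin.val_natAdd, Set.mem_Icc]
    rw [if_pos (by lia)]
    refine ite_congr (propext (by lia)) (fun _ => congrArg f.coeff (by lia)) fun _ => rfl

namespace Polynomial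

theorem resultant_linear {R : Type*} [CommRing R] (a b c d : R) :
    (C a * X + C b).resultant (C c * X + C d) 1 1 = a * d - b * c := by
  rw [resultant, Matrix.det_fin_two]
  simp [Polynomial.sylvester, Fin.addCases, coeff_X, coeff_C]
  ring

theorem resultant_pow_mul_pow_mul {R : Type*} [CommRing R] [IsDomain R] {p q s t : R[X]}
    (hp : p.natDegree = 1) (hq : q.natDegree = 1) (hs : s.natDegree = 1) (ht : t.natDegree = 1)
    (a b : ℕ) :
    (p ^ a * q).resultant (s ^ b * t) (a + 1) (b + 1) =
      (p.resultant s 1 1 ^ b * p.resultant t 1 1) ^ a *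
        (q.resultant s 1 1 ^ b * q.resultant t 1 1) := by
  have ne_zero {f : R[X]} (hf : f.natDegree = 1) : f ≠ 0 := by
    rintro rfl
    simp at hf
  have right {f : R[X]} (hf : f.natDegree = 1) :
      f.resultant (s ^ b * t) 1 (b + 1) = f.resultant s 1 1 ^ b * f.resultant t 1 1 := by
    have hmul := resultant_mul_right f (s ^ b) t 1 hf.le
    have hpow := resultant_pow_right f s 1 b hf.le (by simp [ne_zero hs])
    simp only [natDegree_pow, hs, ht, mul_one] at hmul hpow
    rw [hmul, hpow]
  have hdeg : (s ^ b * t).natDegree ≤ b + 1 := by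
    rw [natDegree_mul (pow_ne_zero _ (ne_zero hs)) (ne_zero ht), natDegree_pow, hs, ht, mul_one]
  have hmul := resultant_mul_left (p ^ a) q (s ^ b * t) (b + 1) hdeg
  have hpow := resultant_pow_left p (s ^ b * t) a (b + 1) (by simp [ne_zero hp]) hdeg
  simp only [natDegree_pow, hp, hq, mul_one] at hmul hpow
  rw [hmul, hpow, right hp, right hq]

end Polynomial

/-- the resultant (w.r.t. formal degrees `n`, `k`) of
`(xg + m)^(n-1)(xg + m − 1)` and `(iyg + 1 − m)^(k-1)(iyg − m)` in `ℂ[m,x,y][g]` equals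
`(−1)^(nk) m^(n-1)(m−1)^(k-1)(x + iy)^(n+k−2)((m−1)x + imy)^((n−1)(k−1))(mx + i(m−1)y)`. -/
theorem stmt14 (n k : ℕ) (hn : 1 ≤ n) (hk : 1 ≤ k)
    (m x y : MvPolynomial (Fin 3) ℂ)
    (hm : m = MvPolynomial.X 0) (hx : x = MvPolynomial.X 1) (hy : y = MvPolynomial.X 2)
    (A B : Polynomial (MvPolynomial (Fin 3) ℂ))
    (hA : A = (Polynomial.C x * Polynomial.X + Polynomial.C m) ^ (n - 1) *
        (Polynomial.C x * Polynomial.X + Polynomial.C m - 1))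
    (hB : B = (Polynomial.C (MvPolynomial.C Complex.I * y) * Polynomial.X +
          Polynomial.C (1 - m)) ^ (k - 1) *
        (Polynomial.C (MvPolynomial.C Complex.I * y) * Polynomial.X - Polynomial.C m)) :
    (sylvester n k A.coeff B.coeff).det =
      (-1) ^ (n * k) * m ^ (n - 1) * (m - 1) ^ (k - 1) *
        (x + MvPolynomial.C Complex.I * y) ^ (n + k - 2) *
        ((m - 1) * x + MvPolynomial.C Complex.I * m * y) ^ ((n - 1) * (k - 1)) *
        (m * x + MvPolynomial.C Complex.I * (m - 1) * y) := by
  obtain ⟨a, rfl⟩ := Nat.exists_eq_add_of_le' hn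
  obtain ⟨b, rfl⟩ := Nat.exists_eq_add_of_le' hk
  have hx0 : x ≠ 0 := hx ▸ MvPolynomial.X_ne_zero 1
  have hy0 : MvPolynomial.C Complex.I * y ≠ 0 :=
    mul_ne_zero (by simp) (hy ▸ MvPolynomial.X_ne_zero 2)
  rw [add_sub_assoc, ← Polynomial.C_1, ← Polynomial.C_sub] at hA
  rw [sub_eq_add_neg _ (Polynomial.C m), ← Polynomial.C_neg] at hB
  rw [det_sylvester_coeff, hA, hB, Nat.add_sub_cancel, Nat.add_sub_cancel,
    Polynomial.resultant_pow_mul_pow_mul (Polynomial.natDegree_linear hx0)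
      (Polynomial.natDegree_linear hx0) (Polynomial.natDegree_linear hy0)
      (Polynomial.natDegree_linear hy0)]
  simp only [Polynomial.resultant_linear]
  generalize MvPolynomial.C Complex.I = i
  rw [show a + 1 + (b + 1) - 2 = a + b by lia,
    show x * (1 - m) - m * (i * y) = -1 * ((m - 1) * x + i * m * y) by ring,
    show x * -m - m * (i * y) = -1 * m * (x + i * y) by ring,
    show x * (1 - m) - (m - 1) * (i * y) = -1 * (m - 1) * (x + i * y) by ring,
    show x * -m - (m - 1) * (i * y) = -1 * (m * x + i * (m - 1) * y) by ring]
  simp only [mul_pow, ← pow_mul]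
  ring
end

section
/- Let n, k ≥ 1 and fix weights a₁, …, aₙ ≥ 0 with a₁ + ⋯ + aₙ = 1 and b₁, …, b_k ≥ 0 with b₁ + ⋯ + b_k = 1. For (α, β) = (α₁, …, αₙ, β₁, …, β_k) ∈ ℝⁿ × ℝ^k, let Ω(α, β) be the set of (x, y) ∈ ℝ² for which there exist g ∈ ℂ with g ∉ ℝ and g ∉ iℝ, and m ∈ ℝ, satisfying Π_{i=1}^{n}(g(x − αᵢ) + m) = Σ_{i=1}^{n} aᵢ·Π_{s≠i}(g(x − α_s) + m) and Π_{j=1}^{k}(ig(y − β_j) + 1 − m) = Σ_{j=1}^{k} b_j·Π_{s≠j}(ig(y − β_s) + 1 − m). Then for Lebesgue-almost every (α, β) ∈ ℝ^{n+k}, there exists a nonzero polynomial f ∈ ℝ[X, Y] in two variables with real coefficients such that f(x, y) = 0 for every (x, y) ∈ Ω(α, β); that is, Ω(α, β) lies on a real algebraic curve. -/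
open Filter MeasureTheory
open IntermediateField Polynomial

section
variable {ι : Type*} [Fintype ι] [DecidableEq ι]

/-- Clearing denominators in `∑ aᵢ / dᵢ`. -/
lemma sum_div_mul_prod {F : Type*} [Field F] (a d : ι → F) (hd : ∀ i, d i ≠ 0) :
    (∑ i, a i / d i) * ∏ i, d i = ∑ i, a i * ∏ s ∈ Finset.univ.erase i, d s := by
  rw [Finset.sum_mul]
  refine Finset.sum_congr rfl fun i _ => ?_
  rw [← Finset.mul_prod_erase _ _ (Finset.mem_univ i)]
  field_simp [hd i]

lemma natDegree_quad_le {K : Type*} [Field K] (A B D : K) :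
    (C A * X ^ 2 + C B * X + C D).natDegree ≤ 2 := by compute_degree

/-- If the Cauchy transform of a normalised atomic measure takes the value `γ / u` at
`A u + B + D / u`, with `u` transcendental over the field of coefficients, then `γ A = 1`. -/
lemma mul_eq_one_of_cauchy_eq {K M : Type*} [Field K] [Field M] [Algebra K M]
    {u : M} (hu : Transcendental K u) (a α : ι → K) (ha : ∑ i, a i = 1) {γ A B D : K} (hγ : γ ≠ 0)
    {z : M} (hz : z = algebraMap K M A * u + algebraMap K M B + algebraMap K M D * u⁻¹)
    (hne : ∀ i, z - algebraMap K M (α i) ≠ 0)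
    (hG : ∑ i, algebraMap K M (a i) / (z - algebraMap K M (α i)) = algebraMap K M γ * u⁻¹) :
    γ * A = 1 := by
  have hu0 : u ≠ 0 := by
    rintro rfl
    exact hu isAlgebraic_zero
  have hinj := transcendental_iff_injective.mp hu
  have hι : Nonempty ι := by
    by_contra h
    rw [not_nonempty_iff] at h
    simp at ha
  let q : ι → K[X] := fun i => C A * X ^ 2 + C (B - α i) * X + C D
  have hq : ∀ i, aeval u (q i) = u * (z - algebraMap K M (α i)) := by
    intro i
    simp only [q, hz, map_add, map_mul, map_sub, aeval_C, aeval_X, map_pow]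
    field_simp
    ring
  have hqd : ∀ i, (q i).natDegree ≤ 2 := fun i => natDegree_quad_le _ _ _
  have hq2 : ∀ i, (q i).coeff 2 = A := fun i => by simp [q]
  have key : C γ * ∏ i, q i = X ^ 2 * ∑ i, C (a i) * ∏ s ∈ Finset.univ.erase i, q s := by
    apply hinj
    simp only [map_mul, map_sum, map_prod, map_pow, aeval_X, aeval_C, hq]
    rw [← sum_div_mul_prod (fun i => algebraMap K M (a i))
      (fun i => u * (z - algebraMap K M (α i))) (fun i => mul_ne_zero hu0 (hne i))]
    have : ∑ i, algebraMap K M (a i) / (u * (z - algebraMap K M (α i)))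
        = u⁻¹ * (algebraMap K M γ * u⁻¹) := by
      rw [← hG, Finset.mul_sum]
      refine Finset.sum_congr rfl fun i _ => ?_
      rw [← div_div]; field_simp
    rw [this]
    field_simp
  obtain ⟨r, hr⟩ : ∃ r, Fintype.card ι = r + 1 :=
    ⟨_, (Nat.succ_pred_eq_of_pos Fintype.card_pos).symm⟩
  have top : γ * A ^ (r + 1) = A ^ r := by
    have h := congrArg (fun p => p.coeff ((r + 1) * 2)) key
    simp only [coeff_C_mul] at h
    have h1 := coeff_prod_of_natDegree_le Finset.univ q 2 (fun p _ => hqd p)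
    rw [Finset.card_univ, hr] at h1
    rw [h1, show (r + 1) * 2 = r * 2 + 2 by ring, coeff_X_pow_mul, finsetSum_coeff] at h
    have h2 : ∀ i, (C (a i) * ∏ s ∈ Finset.univ.erase i, q s).coeff (r * 2) = a i * A ^ r := by
      intro i
      have h3 := coeff_prod_of_natDegree_le (Finset.univ.erase i) q 2 (fun p _ => hqd p)
      have h4 : (Finset.univ.erase i).card = r := by
        rw [Finset.card_erase_of_mem (Finset.mem_univ i), Finset.card_univ, hr]; simp
      rw [h4] at h3
      rw [coeff_C_mul, h3]
      simp [hq2, h4]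
    simp only [h2, ← Finset.sum_mul, ha, hq2, Finset.prod_const, Finset.card_univ, hr] at h
    simpa using h
  by_cases hA : A = 0
  · exfalso
    have hD : D = 0 := by
      have h := congrArg (fun p => p.eval 0) key
      simp [eval_prod, q, hγ] at h
      exact h
    have hzB : z = algebraMap K M B := by simp [hz, hA, hD]
    have h5 : algebraMap K M (∑ i, a i / (B - α i)) = algebraMap K M γ * u⁻¹ := by
      rw [← hG, hzB]; simp
    apply hu
    have h6 : u = algebraMap K M (γ / ∑ i, a i / (B - α i)) := by
      have h7 : algebraMap K M (∑ i, a i / (B - α i)) ≠ 0 := by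
        rw [h5]; exact mul_ne_zero (by simpa using hγ) (inv_ne_zero hu0)
      rw [map_div₀, eq_div_iff h7, h5]
      field_simp
    rw [h6]
    exact isAlgebraic_algebraMap _
  · have := pow_ne_zero r hA
    apply mul_right_cancel₀ this
    rw [one_mul]; linear_combination top
end

/-- The elements of `M` algebraic over the simple extension `k(t)`. -/
noncomputable def relAlgClosure (k : Type*) {M : Type*} [Field k] [Field M] [Algebra k M] (t : M) :
    IntermediateField k M :=
  (algebraicClosure k⟮t⟯ M).restrictScalars k

section
variable {k M : Type*} [Field k] [Field M] [Algebra k M]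

lemma mem_relAlgClosure {t x : M} : x ∈ relAlgClosure k t ↔ IsAlgebraic k⟮t⟯ x := by
  rw [relAlgClosure, IntermediateField.mem_restrictScalars, mem_algebraicClosure_iff]

lemma self_mem_relAlgClosure (t : M) : t ∈ relAlgClosure k t :=
  mem_relAlgClosure.2 (isAlgebraic_algebraMap (AdjoinSimple.gen k t))

lemma mem_relAlgClosure_of_isAlgebraic {t x : M} (hx : IsAlgebraic (relAlgClosure k t) x) :
    x ∈ relAlgClosure k t := by
  rw [mem_relAlgClosure]
  have h : IsAlgebraic (algebraicClosure k⟮t⟯ M) x := hx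
  exact h.restrictScalars k⟮t⟯

open scoped algebraAdjoinAdjoin in
lemma not_algebraicIndependent_of_mem_relAlgClosure {t x y : M} (hx : x ∈ relAlgClosure k t)
    (hy : y ∈ relAlgClosure k t) : ¬ AlgebraicIndependent k ![x, y] := by
  intro h
  have hcl : ∀ z ∈ relAlgClosure k t, z ∈ (AlgebraicIndependent.matroid k M).closure {t} := by
    intro z hz
    rw [AlgebraicIndependent.matroid_closure_eq, SetLike.mem_coe, Subalgebra.mem_algebraicClosure]
    exact (IsFractionRing.isAlgebraic_iff (Algebra.adjoin k {t}) k⟮t⟯ M).2 (mem_relAlgClosure.1 hz)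
  have hind : (AlgebraicIndependent.matroid k M).Indep (Set.range ![x, y]) :=
    AlgebraicIndependent.matroid_indep_iff.2 h.coe_range
  have hsub : Set.range ![x, y] ⊆ (AlgebraicIndependent.matroid k M).closure {t} := by
    rintro _ ⟨i, rfl⟩
    fin_cases i
    exacts [hcl _ hx, hcl _ hy]
  have h1 := (AlgebraicIndependent.matroid k M).eRk_mono hsub
  rw [Matroid.eRk_closure_eq, hind.eRk_eq_encard, ← Set.image_univ,
    h.injective.encard_image, Set.encard_univ, ENat.card_eq_coe_fintype_card] at h1
  have h2 := h1.trans ((AlgebraicIndependent.matroid k M).eRk_le_encard {t})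
  simp at h2

/-- Any two transcendental elements are related by an isomorphism over the base field. -/
lemma exists_algHom_of_transcendental {K M N : Type*} [Field K] [Field M] [Field N] [Algebra K M]
    [Algebra K N] [IsAlgClosed N] {s : M} {t : N} (hs : Transcendental K s)
    (ht : Transcendental K t) :
    ∃ σ : relAlgClosure K s →ₐ[K] N, σ ⟨s, self_mem_relAlgClosure s⟩ = t := by
  let e : K⟮s⟯ →ₐ[K] N := (K⟮t⟯.val.comp (RatFunc.algEquivOfTranscendental t ht).toAlgHom).comp
      (RatFunc.algEquivOfTranscendental s hs).symm.toAlgHom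
  let _ : Algebra K⟮s⟯ N := e.toRingHom.toAlgebra
  have : IsScalarTower K K⟮s⟯ N := IsScalarTower.of_algebraMap_eq fun c => (e.commutes c).symm
  have : FaithfulSMul K⟮s⟯ (algebraicClosure K⟮s⟯ M) :=
    (faithfulSMul_iff_algebraMap_injective _ _).2
      (algebraMap K⟮s⟯ (algebraicClosure K⟮s⟯ M)).injective
  have : Module.IsTorsionFree K⟮s⟯ (algebraicClosure K⟮s⟯ M) :=
    Module.isTorsionFree_iff_faithfulSMul.2 this
  let σ : algebraicClosure K⟮s⟯ M →ₐ[K⟮s⟯] N := IsAlgClosed.lift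
  refine ⟨σ.restrictScalars K, ?_⟩
  have h : σ (algebraMap K⟮s⟯ _ (AdjoinSimple.gen K s)) = e (AdjoinSimple.gen K s) := σ.commutes _
  refine Eq.trans h ?_
  simp [e]
end

section
variable {ι κ : Type*} [Fintype ι] [Fintype κ] {k M N : Type*} [Field k] [Field M] [Algebra k M]
  [Field N] [Algebra k N]

/-- The Cauchy transform of the measure with weights `a` and atoms `α` is regular at `z`, with
value `g`. -/
def CauchyEq (a α : ι → k) (g z : M) : Prop :=
  (∀ i, z - algebraMap k M (α i) ≠ 0) ∧
    ∑ i, algebraMap k M (a i) / (z - algebraMap k M (α i)) = g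

lemma CauchyEq.map_iff {a α : ι → k} {g z : M} (σ : M →ₐ[k] N) :
    CauchyEq a α (σ g) (σ z) ↔ CauchyEq a α g z := by
  have h : ∀ i, σ z - algebraMap k N (α i) = σ (z - algebraMap k M (α i)) := by simp
  have h' : ∑ i, algebraMap k N (a i) / σ (z - algebraMap k M (α i))
      = σ (∑ i, algebraMap k M (a i) / (z - algebraMap k M (α i))) := by simp
  simp only [CauchyEq, h, h', ne_eq, map_eq_zero]
  exact and_congr_right fun _ => σ.injective.eq_iff

lemma CauchyEq.mem_relAlgClosure [DecidableEq ι] {a α : ι → k} {g z t : M}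
    (h : CauchyEq a α g z) (hg : g ≠ 0) (hgt : g ∈ relAlgClosure k t) : z ∈ relAlgClosure k t := by
  apply mem_relAlgClosure_of_isAlgebraic
  let E := relAlgClosure k t
  let l : ι → E[X] := fun i => X - C (algebraMap k E (α i))
  have hl : ∀ i, (l i).Monic := fun i => monic_X_sub_C _
  have hl1 : ∀ i, (l i).natDegree = 1 := fun i => natDegree_X_sub_C _
  let S : E[X] := ∑ i, C (algebraMap k E (a i)) * ∏ s ∈ Finset.univ.erase i, l s
  have hz : ∀ i, aeval z (l i) = z - algebraMap k M (α i) := by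
    intro i
    simp only [l, map_sub, aeval_X, aeval_C]
    rfl
  refine ⟨C ⟨g, hgt⟩ * ∏ i, l i - S, ?_, ?_⟩
  · intro h0
    have h1 := congrArg (fun p => p.coeff (Fintype.card ι)) h0
    have hP : (∏ i, l i).coeff (Fintype.card ι) = 1 := by
      have := (monic_prod_of_monic Finset.univ l fun i _ => hl i).coeff_natDegree
      rwa [natDegree_prod_of_monic _ _ fun i _ => hl i, Finset.sum_congr rfl fun i _ => hl1 i,
        Finset.sum_const, smul_eq_mul, mul_one, Finset.card_univ] at this
    have hS : S.coeff (Fintype.card ι) = 0 := by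
      rw [finsetSum_coeff]
      refine Finset.sum_eq_zero fun i _ => ?_
      rw [coeff_C_mul, coeff_eq_zero_of_natDegree_lt, mul_zero]
      rw [natDegree_prod_of_monic _ _ fun i _ => hl i, Finset.sum_congr rfl fun i _ => hl1 i,
        Finset.sum_const, smul_eq_mul, mul_one, ← Finset.card_univ]
      exact Finset.card_erase_lt_of_mem (Finset.mem_univ i)
    simp only [coeff_sub, coeff_C_mul, hP, hS, mul_one, sub_zero, coeff_zero] at h1
    exact hg (congrArg Subtype.val h1)
  · simp only [S, map_sub, map_mul, map_sum, map_prod, aeval_C, hz]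
    have h2 := sum_div_mul_prod (fun i => algebraMap k M (a i)) (fun i => z - algebraMap k M (α i))
      h.1
    rw [h.2] at h2
    exact sub_eq_zero.2 h2

lemma transcendental_relAlgClosure {t x : M} (hx : x ∉ relAlgClosure k t) :
    Transcendental (relAlgClosure k t) x :=
  fun h => hx (mem_relAlgClosure_of_isAlgebraic h)

/-- Given a solution `(x, y, m, g, h)` of the Cauchy transform system, with `h` playing the role of
the conjugate of `g`, the coordinates `x` and `y` are algebraically dependent. -/
theorem not_algebraicIndependent_of_cauchyEq [DecidableEq ι] [DecidableEq κ] [IsAlgClosed M]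
    [CharZero M] (a α : ι → k) (b β : κ → k) (ha : ∑ i, a i = 1) (hb : ∑ j, b j = 1)
    {i x y m g h : M} (hi : i ^ 2 = -1) (hg : g ≠ 0) (hh : h ≠ 0) (hgh : g ≠ h)
    (h1 : CauchyEq a α g (x + m / g)) (h2 : CauchyEq a α h (x + m / h))
    (h3 : CauchyEq b β (i * g) (y + (1 - m) / (i * g)))
    (h4 : CauchyEq b β (-(i * h)) (y + (1 - m) / (-(i * h)))) :
    ¬ AlgebraicIndependent k ![x, y] := by
  intro hxy
  have hi0 : i ≠ 0 := by
    rintro rfl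
    norm_num at hi
  have hiE : ∀ t : M, i ∈ relAlgClosure k t := by
    intro t
    refine mem_relAlgClosure_of_isAlgebraic ⟨X ^ 2 + 1, ?_, by simp [hi]⟩
    exact (by monicity! : (X ^ 2 + 1 : (relAlgClosure k t)[X]).Monic).ne_zero
  set z := x + m / g with hz
  set w := x + m / h with hw
  set z' := y + (1 - m) / (i * g) with hz'
  set w' := y + (1 - m) / (-(i * h)) with hw'
  have hzE : ∀ t, g ∈ relAlgClosure k t → z ∈ relAlgClosure k t ∧ z' ∈ relAlgClosure k t :=
    fun t ht => ⟨h1.mem_relAlgClosure hg ht,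
      h3.mem_relAlgClosure (mul_ne_zero hi0 hg) (mul_mem (hiE t) ht)⟩
  have hwE : ∀ t, h ∈ relAlgClosure k t → w ∈ relAlgClosure k t ∧ w' ∈ relAlgClosure k t :=
    fun t ht => ⟨h2.mem_relAlgClosure hh ht,
      h4.mem_relAlgClosure (neg_ne_zero.2 (mul_ne_zero hi0 hh)) (neg_mem (mul_mem (hiE t) ht))⟩
  have hnot : ∀ t, g ∈ relAlgClosure k t → h ∉ relAlgClosure k t := by
    intro t hgt hht
    have hm : m = (z - w) / (g⁻¹ - h⁻¹) := by
      have : g⁻¹ - h⁻¹ ≠ 0 := sub_ne_zero.2 fun e => hgh (inv_injective e)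
      rw [eq_div_iff this, hz, hw]
      ring
    have hmE : m ∈ relAlgClosure k t := by
      rw [hm]
      exact div_mem (sub_mem (hzE t hgt).1 (hwE t hht).1) (sub_mem (inv_mem hgt) (inv_mem hht))
    refine not_algebraicIndependent_of_mem_relAlgClosure (t := t) ?_ ?_ hxy
    · rw [show x = z - m / g by rw [hz]; ring]
      exact sub_mem (hzE t hgt).1 (div_mem hmE hgt)
    · rw [show y = z' - (1 - m) / (i * g) by rw [hz']; ring]
      exact sub_mem (hzE t hgt).2 (div_mem (sub_mem (one_mem _) hmE) (mul_mem (hiE t) hgt))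
  have hg1 : g ∈ relAlgClosure k g := self_mem_relAlgClosure g
  have hh1 : h ∈ relAlgClosure k h := self_mem_relAlgClosure h
  have hrel : g⁻¹ * (z + i * z' - g⁻¹) - h⁻¹ * (w - i * w' - h⁻¹) + h⁻¹ * (z - i * z')
      - g⁻¹ * (w + i * w') = 0 := by
    rw [hz, hw, hz', hw']
    field_simp
    ring_nf
  have hh1' : h + 1 ∉ relAlgClosure k g := fun e =>
    hnot g hg1 (by simpa using sub_mem e (one_mem _))
  -- `σ` fixes everything algebraic over `k(g)` and moves `h` to `h + 1`.
  obtain ⟨σ, hσ⟩ := exists_algHom_of_transcendental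
    (transcendental_relAlgClosure (hnot g hg1)) (transcendental_relAlgClosure hh1')
  let T := relAlgClosure (relAlgClosure k g) h
  have hT1 : ∀ c : M, c ∈ relAlgClosure k g → c ∈ T := fun c hc =>
    T.algebraMap_mem ⟨c, hc⟩
  have hTh : h ∈ T := self_mem_relAlgClosure h
  have h2' : CauchyEq (fun i => algebraMap k (relAlgClosure k g) (a i))
    (fun i => algebraMap k (relAlgClosure k g) (α i)) h w := h2
  have h4' : CauchyEq (fun i => algebraMap k (relAlgClosure k g) (b i))
    (fun i => algebraMap k (relAlgClosure k g) (β i)) (-(i * h)) w' := h4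
  have hwT : w ∈ T := h2'.mem_relAlgClosure hh hTh
  have hiT : i ∈ T := hT1 _ (hiE g)
  have hwT' : w' ∈ T := h4'.mem_relAlgClosure
    (neg_ne_zero.2 (mul_ne_zero hi0 hh)) (neg_mem (mul_mem hiT hTh))
  have hσfix : ∀ (c : M) (hc : c ∈ relAlgClosure k g) (hcT : c ∈ T), σ ⟨c, hcT⟩ = c :=
    fun c hc _ => σ.commutes ⟨c, hc⟩
  have hσh : σ ⟨h, hTh⟩ = h + 1 := hσ
  have hσi : σ ⟨i, hiT⟩ = i := hσfix i (hiE g) _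
  set v := σ ⟨w, hwT⟩ with hv
  set v' := σ ⟨w', hwT'⟩ with hv'
  have hh10 : h + 1 ≠ 0 := fun e => hh1' (by rw [e]; exact zero_mem _)
  have hk1 : h + 1 ∈ relAlgClosure k h := add_mem hh1 (one_mem _)
  have h2v : CauchyEq a α (h + 1) v := by
    have e : CauchyEq (fun i => algebraMap k (relAlgClosure k g) (a i))
        (fun i => algebraMap k (relAlgClosure k g) (α i)) (⟨h, hTh⟩ : T) ⟨w, hwT⟩ :=
      (CauchyEq.map_iff T.val).1 h2'
    rw [← CauchyEq.map_iff σ, hσh] at e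
    exact e
  have h4v : CauchyEq b β (-(i * (h + 1))) v' := by
    have e : CauchyEq (fun i => algebraMap k (relAlgClosure k g) (b i))
        (fun i => algebraMap k (relAlgClosure k g) (β i))
        (-(⟨i, hiT⟩ * ⟨h, hTh⟩) : T) ⟨w', hwT'⟩ :=
      (CauchyEq.map_iff T.val).1 h4'
    rw [← CauchyEq.map_iff σ, map_neg, map_mul, hσh, hσi] at e
    exact e
  have hrelv : g⁻¹ * (z + i * z' - g⁻¹) - (h + 1)⁻¹ * (v - i * v' - (h + 1)⁻¹)
      + (h + 1)⁻¹ * (z - i * z') - g⁻¹ * (v + i * v') = 0 := by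
    have hgT := hT1 _ hg1
    have hzT := hT1 _ (hzE g hg1).1
    have hzT' := hT1 _ (hzE g hg1).2
    have e : (⟨g, hgT⟩⁻¹ * (⟨z, hzT⟩ + ⟨i, hiT⟩ * ⟨z', hzT'⟩ - ⟨g, hgT⟩⁻¹)
        - ⟨h, hTh⟩⁻¹ * (⟨w, hwT⟩ - ⟨i, hiT⟩ * ⟨w', hwT'⟩ - ⟨h, hTh⟩⁻¹)
        + ⟨h, hTh⟩⁻¹ * (⟨z, hzT⟩ - ⟨i, hiT⟩ * ⟨z', hzT'⟩)
        - ⟨g, hgT⟩⁻¹ * (⟨w, hwT⟩ + ⟨i, hiT⟩ * ⟨w', hwT'⟩) : T) = 0 := Subtype.ext hrel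
    have hmap := congrArg σ e
    simpa only [map_sub, map_add, map_mul, map_inv₀, map_zero, hσh, hσi, hσfix g hg1,
      hσfix z (hzE g hg1).1, hσfix z' (hzE g hg1).2, ← hv, ← hv'] using hmap
  -- Comparing both relations expresses both solutions at `g` in terms of `g⁻¹`
  -- over the field of elements algebraic over `k(h)`.
  let K := relAlgClosure k h
  have hwK := hwE h hh1
  have hvK : v ∈ K := h2v.mem_relAlgClosure hh10 hk1
  have hvK' : v' ∈ K := h4v.mem_relAlgClosure
    (neg_ne_zero.2 (mul_ne_zero hi0 hh10)) (neg_mem (mul_mem (hiE h) hk1))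
  have hiK : i ∈ K := hiE h
  have hgK : g ∉ K := fun e => hnot h e hh1
  have hu : Transcendental K g⁻¹ :=
    transcendental_relAlgClosure fun e => hgK (by simpa using inv_mem e)
  obtain ⟨p, hp⟩ : ∃ p, p = h⁻¹ * (w - i * w' - h⁻¹) := ⟨_, rfl⟩
  obtain ⟨q, hq⟩ : ∃ q, q = w + i * w' := ⟨_, rfl⟩
  obtain ⟨p₁, hp₁⟩ : ∃ p, p = (h + 1)⁻¹ * (v - i * v' - (h + 1)⁻¹) := ⟨_, rfl⟩
  obtain ⟨q₁, hq₁⟩ : ∃ q, q = v + i * v' := ⟨_, rfl⟩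
  have hpK : p ∈ K := hp ▸ mul_mem (inv_mem hh1)
    (sub_mem (sub_mem hwK.1 (mul_mem hiK hwK.2)) (inv_mem hh1))
  have hqK : q ∈ K := hq ▸ add_mem hwK.1 (mul_mem hiK hwK.2)
  have hpK₁ : p₁ ∈ K := hp₁ ▸ mul_mem (inv_mem hk1)
    (sub_mem (sub_mem hvK (mul_mem hiK hvK')) (inv_mem hk1))
  have hqK₁ : q₁ ∈ K := hq₁ ▸ add_mem hvK (mul_mem hiK hvK')
  rw [← hp, ← hq] at hrel
  rw [← hp₁, ← hq₁] at hrelv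
  have hδ : h⁻¹ - (h + 1)⁻¹ ≠ 0 := sub_ne_zero.2 fun e => by simpa using inv_injective e
  have hδK : h⁻¹ - (h + 1)⁻¹ ∈ K := sub_mem (inv_mem hh1) (inv_mem hk1)
  obtain ⟨c, hc⟩ : ∃ c, c = (p - p₁) / (h⁻¹ - (h + 1)⁻¹) := ⟨_, rfl⟩
  obtain ⟨d, hd⟩ : ∃ d, d = (q - q₁) / (h⁻¹ - (h + 1)⁻¹) := ⟨_, rfl⟩
  have hcK : c ∈ K := hc ▸ div_mem (sub_mem hpK hpK₁) hδK
  have hdK : d ∈ K := hd ▸ div_mem (sub_mem hqK hqK₁) hδK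
  have hr : z - i * z' = c + d * g⁻¹ := by
    apply mul_left_cancel₀ hδ
    have ec : (h⁻¹ - (h + 1)⁻¹) * c = p - p₁ := by rw [hc]; field_simp
    have ed : (h⁻¹ - (h + 1)⁻¹) * d = q - q₁ := by rw [hd]; field_simp
    linear_combination hrel - hrelv - ec - g⁻¹ * ed
  obtain ⟨e, he⟩ : ∃ e, e = p - h⁻¹ * c := ⟨_, rfl⟩
  obtain ⟨f, hf⟩ : ∃ f, f = q - h⁻¹ * d := ⟨_, rfl⟩
  have heK : e ∈ K := he ▸ sub_mem hpK (mul_mem (inv_mem hh1) hcK)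
  have hfK : f ∈ K := hf ▸ sub_mem hqK (mul_mem (inv_mem hh1) hdK)
  have hs : z + i * z' = g⁻¹ + f + e * g := by
    apply mul_left_cancel₀ (inv_ne_zero hg)
    rw [hr] at hrel
    have : g⁻¹ * g = 1 := inv_mul_cancel₀ hg
    linear_combination hrel - g⁻¹ * hf - he - e * this
  let i₀ : K := ⟨i, hiK⟩
  let c₀ : K := ⟨c, hcK⟩
  let d₀ : K := ⟨d, hdK⟩
  let e₀ : K := ⟨e, heK⟩
  let f₀ : K := ⟨f, hfK⟩
  have hi₀ : i₀ ≠ 0 := fun e => hi0 (congrArg Subtype.val e)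
  have r1 := mul_eq_one_of_cauchy_eq hu (fun i => algebraMap k K (a i))
    (fun i => algebraMap k K (α i)) (by rw [← map_sum, ha, map_one]) (γ := 1)
    (A := (1 + d₀) / 2) (B := (f₀ + c₀) / 2) (D := e₀ / 2) one_ne_zero (z := z)
    (by
      change z = (1 + d) / 2 * g⁻¹ + (f + c) / 2 + e / 2 * g⁻¹⁻¹
      rw [inv_inv]
      linear_combination (hr + hs) / 2)
    h1.1 (by
      refine h1.2.trans ?_
      simp)
  have r2 := mul_eq_one_of_cauchy_eq hu (fun i => algebraMap k K (b i))
    (fun i => algebraMap k K (β i)) (by rw [← map_sum, hb, map_one]) (γ := i₀)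
    (A := (1 - d₀) / (2 * i₀)) (B := (f₀ - c₀) / (2 * i₀)) (D := e₀ / (2 * i₀)) hi₀ (z := z')
    (by
      change z' = (1 - d) / (2 * i) * g⁻¹ + (f - c) / (2 * i) + e / (2 * i) * g⁻¹⁻¹
      rw [inv_inv]
      have : z' = (2 * i * z') / (2 * i) := by field_simp
      rw [this, show 2 * i * z' = (1 - d) * g⁻¹ + (f - c) + e * g by linear_combination hs - hr]
      ring)
    h3.1 (by
      refine h3.2.trans ?_
      rw [inv_inv]
      rfl)
  have hd1 : d₀ = 1 := by
    field_simp at r1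
    linear_combination r1
  rw [hd1] at r2
  simp at r2
end

/-- A Zariski dense family of real points has a generic point over an algebraically closed
field, compatible with all complex functions on the family. -/
lemma exists_algHom_algebraicIndependent {T ι : Type} (X : ι → T → ℝ)
    (hX : ∀ f : MvPolynomial ι ℝ, f ≠ 0 → ∃ t, MvPolynomial.eval (fun i => X i t) f ≠ 0) :
    ∃ (M : Type) (_ : Field M) (_ : IsAlgClosed M) (_ : Algebra ℝ M) (φ : (T → ℂ) →ₐ[ℝ] M),
      AlgebraicIndependent ℝ (fun i => φ (fun t => (X i t : ℂ))) := by
  let ev : MvPolynomial ι ℝ →ₐ[ℝ] (T → ℂ) := MvPolynomial.aeval fun i t => (X i t : ℂ)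
  have hev : ∀ f t, ev f t = (MvPolynomial.eval (fun i => X i t) f : ℝ) := by
    intro f t
    have h1 : (Pi.evalAlgHom ℝ (fun _ : T => ℂ) t).comp ev
        = Complex.ofRealAm.comp (MvPolynomial.aeval fun i => X i t) := by
      apply MvPolynomial.algHom_ext
      intro i
      simp [ev]
    exact DFunLike.congr_fun h1 f
  let S : Submonoid (T → ℂ) := (nonZeroDivisors (MvPolynomial ι ℝ)).map ev
  have hS : Disjoint ((⊥ : Ideal (T → ℂ)) : Set (T → ℂ)) S := by
    rw [Set.disjoint_left]
    rintro _ h0 ⟨f, hf, rfl⟩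
    obtain ⟨t, ht⟩ := hX f (nonZeroDivisors.ne_zero hf)
    have h1 : ev f = 0 := h0
    have h2 := hev f t
    rw [h1] at h2
    exact ht (Complex.ofReal_eq_zero.1 h2.symm)
  obtain ⟨P, hP, -, hPS⟩ := Ideal.exists_le_prime_disjoint ⊥ S hS
  let M := AlgebraicClosure (FractionRing ((T → ℂ) ⧸ P))
  let ψ : ((T → ℂ) ⧸ P) →ₐ[ℝ] M := IsScalarTower.toAlgHom ℝ ((T → ℂ) ⧸ P) M
  have hψ : Function.Injective ψ := by
    change Function.Injective (algebraMap ((T → ℂ) ⧸ P) M)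
    rw [IsScalarTower.algebraMap_eq ((T → ℂ) ⧸ P) (FractionRing ((T → ℂ) ⧸ P)) M]
    exact (algebraMap (FractionRing ((T → ℂ) ⧸ P)) M).injective.comp
      (IsFractionRing.injective ((T → ℂ) ⧸ P) (FractionRing ((T → ℂ) ⧸ P)))
  refine ⟨M, inferInstance, inferInstance, inferInstance, ψ.comp (Ideal.Quotient.mkₐ ℝ P), ?_⟩
  rw [algebraicIndependent_iff]
  intro f hf
  by_contra hne
  refine Set.disjoint_left.1 hPS (?_ : ev f ∈ P) ⟨f, mem_nonZeroDivisors_of_ne_zero hne, rfl⟩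
  have h1 : (ψ.comp (Ideal.Quotient.mkₐ ℝ P)) (ev f) = 0 := by
    rw [← hf]
    exact DFunLike.congr_fun (MvPolynomial.comp_aeval (fun i t => (X i t : ℂ))
      (ψ.comp (Ideal.Quotient.mkₐ ℝ P))) f
  exact Ideal.Quotient.eq_zero_iff_mem.1 (hψ (h1.trans (map_zero ψ).symm))

/-- The polynomial form of `G(x + m / g) = g`. -/
lemma cauchyEq_of_prod_eq {ι k M : Type*} [Fintype ι] [DecidableEq ι] [Field k] [Field M]
    [Algebra k M] {a α : ι → k} {g x m : M} (hg : g ≠ 0)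
    (hd : ∀ i, g * (x - algebraMap k M (α i)) + m ≠ 0)
    (h : ∏ i, (g * (x - algebraMap k M (α i)) + m) = ∑ i, algebraMap k M (a i) *
      ∏ s ∈ Finset.univ.erase i, (g * (x - algebraMap k M (α s)) + m)) :
    CauchyEq a α g (x + m / g) := by
  have e : ∀ i, x + m / g - algebraMap k M (α i) = (g * (x - algebraMap k M (α i)) + m) / g := by
    intro i
    field_simp
    ring
  refine ⟨fun i => ?_, ?_⟩
  · rw [e]
    exact div_ne_zero (hd i) hg
  · have h1 := sum_div_mul_prod (fun i => algebraMap k M (a i)) _ hd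
    rw [← h] at h1
    have h2 := mul_eq_right₀ (Finset.prod_ne_zero_iff.2 fun i _ => hd i) |>.1 h1
    calc _ = g * ∑ i, algebraMap k M (a i) / (g * (x - algebraMap k M (α i)) + m) := by
          rw [Finset.mul_sum]
          refine Finset.sum_congr rfl fun i _ => ?_
          rw [e, div_div_eq_mul_div]
          ring
      _ = g := by rw [h2, mul_one]

lemma map_ne_zero_of_forall_ne_zero {T M : Type*} [Field M] [Algebra ℝ M] (φ : (T → ℂ) →ₐ[ℝ] M)
    {G : T → ℂ} (hG : ∀ t, G t ≠ 0) : φ G ≠ 0 := by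
  intro h0
  have h1 : G * G⁻¹ = 1 := funext fun t => mul_inv_cancel₀ (hG t)
  have h2 := congrArg φ h1
  rw [map_mul, h0, zero_mul, map_one] at h2
  exact zero_ne_one h2

lemma cauchyEq_map_of_forall {T M ι : Type*} [Fintype ι] [DecidableEq ι] [Field M] [Algebra ℝ M]
    (φ : (T → ℂ) →ₐ[ℝ] M) {a α : ι → ℝ} {G X m : T → ℂ} (hG : ∀ t, G t ≠ 0)
    (hd : ∀ t i, G t * (X t - (α i : ℂ)) + m t ≠ 0)
    (h : ∀ t, ∏ i, (G t * (X t - (α i : ℂ)) + m t) = ∑ i, (a i : ℂ) *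
      ∏ s ∈ Finset.univ.erase i, (G t * (X t - (α s : ℂ)) + m t)) :
    CauchyEq a α (φ G) (φ X + φ m / φ G) := by
  have e : ∀ i, φ G * (φ X - algebraMap ℝ M (α i)) + φ m
      = φ (G * (X - algebraMap ℝ (T → ℂ) (α i)) + m) := by simp
  refine cauchyEq_of_prod_eq (map_ne_zero_of_forall_ne_zero φ hG) (fun i => ?_) ?_
  · rw [e]
    exact map_ne_zero_of_forall_ne_zero φ fun t => hd t i
  · have h1 : ∏ i, (G * (X - algebraMap ℝ (T → ℂ) (α i)) + m)
        = ∑ i, algebraMap ℝ (T → ℂ) (a i) *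
          ∏ s ∈ Finset.univ.erase i, (G * (X - algebraMap ℝ (T → ℂ) (α s)) + m) := by
      funext t
      simpa using h t
    simpa only [map_prod, map_sum, map_mul, map_add, map_sub, AlgHom.commutes] using congrArg φ h1

lemma mul_ofReal_add_ofReal_ne_zero {g : ℂ} (hg : g.im ≠ 0) {r m : ℝ} (hr : r ≠ 0) :
    g * (r : ℂ) + (m : ℂ) ≠ 0 := by
  intro h
  have := congrArg Complex.im h
  simp [hg, hr] at this

/-- For every choice of atoms, the solution set lies on a real algebraic curve. -/
theorem exists_polynomial_vanishing {n k : ℕ} (a : Fin n → ℝ) (b : Fin k → ℝ)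
    (ha : ∑ i, a i = 1) (hb : ∑ j, b j = 1) (α : Fin n → ℝ) (β : Fin k → ℝ) :
    ∃ f : MvPolynomial (Fin 2) ℝ, f ≠ 0 ∧
      ∀ x y : ℝ,
        (∃ g : ℂ, ∃ m : ℝ, g.im ≠ 0 ∧ g.re ≠ 0 ∧
          (∏ i : Fin n, (g * ((x - α i : ℝ) : ℂ) + (m : ℂ))
            = ∑ i : Fin n, ((a i : ℝ) : ℂ) *
                ∏ s ∈ Finset.univ.erase i, (g * ((x - α s : ℝ) : ℂ) + (m : ℂ)))
          ∧ (∏ j : Fin k, (Complex.I * g * ((y - β j : ℝ) : ℂ) + 1 - (m : ℂ))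
            = ∑ j : Fin k, ((b j : ℝ) : ℂ) *
                ∏ s ∈ Finset.univ.erase j,
                  (Complex.I * g * ((y - β s : ℝ) : ℂ) + 1 - (m : ℂ)))) →
        MvPolynomial.eval ![x, y] f = 0 := by
  by_contra! hcon
  let T := {p : ℝ × ℝ × ℂ × ℝ // (∀ i, p.1 - α i ≠ 0) ∧ (∀ j, p.2.1 - β j ≠ 0) ∧
    p.2.2.1.im ≠ 0 ∧ p.2.2.1.re ≠ 0 ∧
    (∏ i : Fin n, (p.2.2.1 * ((p.1 : ℂ) - α i) + p.2.2.2)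
      = ∑ i : Fin n, (a i : ℂ) *
        ∏ s ∈ Finset.univ.erase i, (p.2.2.1 * ((p.1 : ℂ) - α s) + p.2.2.2)) ∧
    (∏ j : Fin k, (Complex.I * p.2.2.1 * ((p.2.1 : ℂ) - β j) + (1 - p.2.2.2))
      = ∑ j : Fin k, (b j : ℂ) *
        ∏ s ∈ Finset.univ.erase j, (Complex.I * p.2.2.1 * ((p.2.1 : ℂ) - β s) + (1 - p.2.2.2)))}
  let x : T → ℝ := fun t => t.1.1
  let y : T → ℝ := fun t => t.1.2.1
  let g : T → ℂ := fun t => t.1.2.2.1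
  let m : T → ℂ := fun t => (t.1.2.2.2 : ℝ)
  have hX : ∀ f : MvPolynomial (Fin 2) ℝ, f ≠ 0 →
      ∃ t, MvPolynomial.eval (fun i => (![x, y] : Fin 2 → T → ℝ) i t) f ≠ 0 := by
    intro f hf
    have hlin : ∀ (i : Fin 2) (c : ℝ), MvPolynomial.X i - MvPolynomial.C c ≠ 0 := by
      intro i c h0
      have := congrArg (MvPolynomial.eval fun _ => c + 1) h0
      simp at this
    obtain ⟨x₀, y₀, ⟨g₀, m₀, h1, h2, h3, h4⟩, h5⟩ := hcon
      (f * (∏ i, (MvPolynomial.X 0 - MvPolynomial.C (α i))) *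
        ∏ j, (MvPolynomial.X 1 - MvPolynomial.C (β j)))
      (mul_ne_zero (mul_ne_zero hf (Finset.prod_ne_zero_iff.2 fun i _ => hlin _ _))
        (Finset.prod_ne_zero_iff.2 fun i _ => hlin _ _))
    simp only [map_mul, map_prod, map_sub, MvPolynomial.eval_X, MvPolynomial.eval_C, mul_ne_zero_iff,
      Finset.prod_ne_zero_iff, Finset.mem_univ, true_imp_iff] at h5
    refine ⟨⟨(x₀, y₀, g₀, m₀), h5.1.2, h5.2, h1, h2, by simpa using h3,
      by simpa [add_sub_assoc] using h4⟩, ?_⟩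
    convert h5.1.1 using 3
    ext i
    fin_cases i <;> rfl
  obtain ⟨M, _, _, _, φ, hφ⟩ := exists_algHom_algebraicIndependent _ hX
  have : CharZero M := charZero_of_injective_algebraMap (algebraMap ℝ M).injective
  have hg : ∀ t, g t ≠ 0 := fun t h => t.2.2.2.1 (by rw [show t.1.2.2.1 = 0 from h]; rfl)
  have hgI : ∀ t : T, (Complex.I * g t).im ≠ 0 := fun t => by simpa using t.2.2.2.2.1
  have hdx : ∀ (t : T) i, g t * ((x t : ℂ) - α i) + m t ≠ 0 := fun t i => by
    simpa using mul_ofReal_add_ofReal_ne_zero (m := t.1.2.2.2) t.2.2.2.1 (t.2.1 i)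
  have hdy : ∀ (t : T) j, Complex.I * g t * ((y t : ℂ) - β j) + (1 - m t) ≠ 0 := fun t j => by
    simpa using mul_ofReal_add_ofReal_ne_zero (m := 1 - t.1.2.2.2) (hgI t) (t.2.2.1 j)
  have hm : ∀ t, starRingEnd ℂ (m t) = m t := fun t => Complex.conj_ofReal _
  have cx : CauchyEq a α (φ g) (φ (fun t => (x t : ℂ)) + φ m / φ g) :=
    cauchyEq_map_of_forall φ hg hdx fun t => t.2.2.2.2.2.1
  have cx' : CauchyEq a α (φ (star g)) (φ (fun t => (x t : ℂ)) + φ m / φ (star g)) := by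
    have e : ∀ t i, star g t * ((x t : ℂ) - α i) + m t
        = starRingEnd ℂ (g t * ((x t : ℂ) - α i) + m t) := by
      intro t i
      simp [hm]
    refine cauchyEq_map_of_forall φ (fun t => star_ne_zero.2 (hg t)) (fun t i => ?_) fun t => ?_
    · rw [e]
      exact star_ne_zero.2 (hdx t i)
    · simp only [e]
      simpa only [map_prod, map_sum, map_mul _ (Complex.ofReal _), Complex.conj_ofReal] using
        congrArg (starRingEnd ℂ) t.2.2.2.2.2.1
  have cy : CauchyEq b β (φ (fun t => Complex.I * g t)) (φ (fun t => (y t : ℂ))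
      + φ (fun t => 1 - m t) / φ (fun t => Complex.I * g t)) :=
    cauchyEq_map_of_forall φ (fun t => mul_ne_zero Complex.I_ne_zero (hg t)) hdy
      fun t => t.2.2.2.2.2.2
  have cy' : CauchyEq b β (φ (fun t => -(Complex.I * star g t))) (φ (fun t => (y t : ℂ))
      + φ (fun t => 1 - m t) / φ (fun t => -(Complex.I * star g t))) := by
    have e : ∀ t i, -(Complex.I * star g t) * ((y t : ℂ) - β i) + (1 - m t)
        = starRingEnd ℂ (Complex.I * g t * ((y t : ℂ) - β i) + (1 - m t)) := by
      intro t i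
      simp [hm]
    refine cauchyEq_map_of_forall φ
      (fun t => neg_ne_zero.2 (mul_ne_zero Complex.I_ne_zero (star_ne_zero.2 (hg t))))
      (fun t i => ?_) fun t => ?_
    · rw [e]
      exact star_ne_zero.2 (hdy t i)
    · simp only [e]
      simpa only [map_prod, map_sum, map_mul _ (Complex.ofReal _), Complex.conj_ofReal] using
        congrArg (starRingEnd ℂ) t.2.2.2.2.2.2
  have e1 : φ (fun t => 1 - m t) = 1 - φ m := by
    rw [← map_one φ, ← map_sub]
    rfl
  have e2 : φ (fun t => Complex.I * g t) = φ (fun _ => Complex.I) * φ g := by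
    rw [← map_mul]
    rfl
  have e3 : φ (fun t => -(Complex.I * star g t)) = -(φ (fun _ => Complex.I) * φ (star g)) := by
    rw [← map_mul, ← map_neg]
    rfl
  rw [e1, e2] at cy
  rw [e1, e3] at cy'
  refine not_algebraicIndependent_of_cauchyEq a α b β ha hb ?_
    (map_ne_zero_of_forall_ne_zero φ hg)
    (map_ne_zero_of_forall_ne_zero φ fun t => star_ne_zero.2 (hg t)) ?_ cx cx' cy cy' ?_
  · rw [← map_pow, ← map_one φ, ← map_neg]
    congr 1
    funext t
    simp
  · rw [← sub_ne_zero, ← map_sub]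
    refine map_ne_zero_of_forall_ne_zero φ fun t h => t.2.2.2.1 ?_
    exact Complex.conj_eq_iff_im.1 (sub_eq_zero.1 h).symm
  · have hvec : ![φ fun t => (x t : ℂ), φ fun t => (y t : ℂ)]
        = fun i => φ fun t => ((![x, y] : Fin 2 → T → ℝ) i t : ℂ) := by
      ext i
      fin_cases i <;> rfl
    rw [hvec]
    exact hφ

theorem stmt16 (n k : ℕ) (hn : 1 ≤ n) (hk : 1 ≤ k)
    (a : Fin n → ℝ) (b : Fin k → ℝ)
    (ha0 : ∀ i, 0 ≤ a i) (hb0 : ∀ j, 0 ≤ b j)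
    (ha : ∑ i, a i = 1) (hb : ∑ j, b j = 1) :
    ∀ᵐ αβ : (Fin n → ℝ) × (Fin k → ℝ) ∂volume,
      ∃ f : MvPolynomial (Fin 2) ℝ, f ≠ 0 ∧
        ∀ x y : ℝ,
          (∃ g : ℂ, ∃ m : ℝ, g.im ≠ 0 ∧ g.re ≠ 0 ∧
            (∏ i : Fin n, (g * ((x - αβ.1 i : ℝ) : ℂ) + (m : ℂ))
              = ∑ i : Fin n, ((a i : ℝ) : ℂ) *
                  ∏ s ∈ Finset.univ.erase i, (g * ((x - αβ.1 s : ℝ) : ℂ) + (m : ℂ)))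
            ∧ (∏ j : Fin k, (Complex.I * g * ((y - αβ.2 j : ℝ) : ℂ) + 1 - (m : ℂ))
              = ∑ j : Fin k, ((b j : ℝ) : ℂ) *
                  ∏ s ∈ Finset.univ.erase j,
                    (Complex.I * g * ((y - αβ.2 s : ℝ) : ℂ) + 1 - (m : ℂ)))) →
          MvPolynomial.eval ![x, y] f = 0 := by
  exact .of_forall fun αβ => exists_polynomial_vanishing a b ha hb αβ.1 αβ.2
end
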